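/- Let T be an operator assigning to each m-tuple f⃗ = (f_1,…,f_m) of bounded compactly supported measurable functions on ℝ^d a measurable function T f⃗, and suppose T satisfies sparse form domination with constant C_T. Let p⃗ = (p_1,…,p_m) ∈ [1,∞]^m, let p ∈ [1/m,∞) be given by 1/p = Σ_{j=1}^m 1/p_j, and let w⃗ = (w_1,…,w_m) ∈ A_{p⃗} with w := ∏_{j=1}^m w_j. Then there is a constant c, depending only on d, m, p⃗ and C_T, such that for all bounded compactly supported measurable f_1,…,f_m one has ‖T f⃗‖_{L^{p,∞}_w(ℝ^d)} ≤ c · [w^p]_FW · [w⃗]_{p⃗} · ∏_{j=1}^m ‖f_j‖_{L^{p_j}_{w_j}(ℝ^d)}. -/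

import Mathlib

open MeasureTheory ENNReal Set

noncomputable section

namespace Paper

variable {d m : ℕ}

abbrev Rd (d : ℕ) := Fin d → ℝ

structure Cube (d : ℕ) where
  corner : Rd d
  side : ℝ
  side_pos : 0 < side

def Cube.set (Q : Cube d) : Set (Rd d) :=
  {x | ∀ i, Q.corner i ≤ x i ∧ x i < Q.corner i + Q.side}

/-- the average `⟨f⟩_{q,Q}` for finite exponent `q`, of an `ℝ≥0∞`-valued function -/
def eAvg (f : Rd d → ℝ≥0∞) (q : ℝ) (Q : Cube d) : ℝ≥0∞ :=
  ((volume Q.set)⁻¹ * ∫⁻ x in Q.set, f x ^ q) ^ (1 / q)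

def ofFn (f : Rd d → ℝ) : Rd d → ℝ≥0∞ := fun x => ENNReal.ofReal |f x|

/-- the average `⟨f⟩_{q,Q}` for finite exponent `q > 0` -/
def avg (f : Rd d → ℝ) (q : ℝ) (Q : Cube d) : ℝ≥0∞ := eAvg (ofFn f) q Q

/-- the average `⟨f⟩_{q,Q}` for exponent `q ∈ (0,∞]` -/
def avgE (f : Rd d → ℝ) (q : ℝ≥0∞) (Q : Cube d) : ℝ≥0∞ :=
  if q = ∞ then essSup (ofFn f) (volume.restrict Q.set) else avg f q.toReal Q

def IsWeight (u : Rd d → ℝ) : Prop :=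
  MeasureTheory.LocallyIntegrable u volume ∧ ∀ᵐ x ∂(volume : Measure (Rd d)), 0 < u x

/-- `u(A) = ∫_A u dx` -/
def wMeas (u : Rd d → ℝ) (A : Set (Rd d)) : ℝ≥0∞ := ∫⁻ x in A, ENNReal.ofReal (u x)

/-- the Hardy–Littlewood maximal operator -/
def maximal (f : Rd d → ℝ) (x : Rd d) : ℝ≥0∞ :=
  ⨆ (Q : Cube d) (_ : x ∈ Q.set), avg f 1 Q

/-- the Fujii–Wilson constant `[u]_FW` -/
def FW (u : Rd d → ℝ) : ℝ≥0∞ :=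
  ⨆ Q : Cube d, (wMeas u Q.set)⁻¹ * ∫⁻ x in Q.set, maximal (Q.set.indicator u) x

/-- Hölder conjugate in `ℝ≥0∞` -/
def conj (q : ℝ≥0∞) : ℝ≥0∞ := (1 - q⁻¹)⁻¹

def prodW (w : Fin m → Rd d → ℝ) : Rd d → ℝ := fun x => ∏ j, w j x

/-- the two-weight multilinear Muckenhoupt constant `[w⃗,ω]_{p⃗}`; here `p0` is the
real number with `1/p0 = ∑ 1/p j`. -/
def APtw (p0 : ℝ) (p : Fin m → ℝ≥0∞) (w : Fin m → Rd d → ℝ) (ω : Rd d → ℝ) : ℝ≥0∞ :=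
  ⨆ Q : Cube d, avg ω p0 Q * ∏ j, avgE (fun x => (w j x)⁻¹) (conj (p j)) Q

/-- the multilinear Muckenhoupt constant `[w⃗]_{p⃗}` -/
def AP (p0 : ℝ) (p : Fin m → ℝ≥0∞) (w : Fin m → Rd d → ℝ) : ℝ≥0∞ :=
  APtw p0 p w (prodW w)

def IsSparse (η : ℝ) (S : Set (Cube d)) : Prop :=
  ∃ E : Cube d → Set (Rd d),
    (∀ Q ∈ S, E Q ⊆ Q.set ∧ MeasurableSet (E Q) ∧
      ENNReal.ofReal η * volume Q.set ≤ volume (E Q)) ∧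
    S.PairwiseDisjoint E

def dyadicGrid (d : ℕ) (α : Rd d) : Set (Cube d) :=
  {Q | ∃ (j : ℤ) (k : Fin d → ℤ),
    Q.side = (2:ℝ) ^ (-j) ∧ ∀ i, Q.corner i = (2:ℝ) ^ (-j) * (α i + k i)}

def IsDyadicGrid (D : Set (Cube d)) : Prop :=
  ∃ α : Rd d, (∀ i, α i = 0 ∨ α i = 1/3 ∨ α i = 2/3) ∧ D = dyadicGrid d α

/-- bounded, compactly supported, measurable -/
def BCS (f : Rd d → ℝ) : Prop :=
  Measurable f ∧ (∃ C, ∀ x, |f x| ≤ C) ∧ HasCompactSupport f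

def sparseForm (S : Set (Cube d)) (f : Fin m → Rd d → ℝ) (g : Rd d → ℝ) : ℝ≥0∞ :=
  ∑' Q : S, (∏ j, avg (f j) 1 Q.1) * avg g 1 Q.1 * volume (Q.1).set

def SparseFormDom (T : (Fin m → Rd d → ℝ) → Rd d → ℝ) (CT : ℝ≥0∞) : Prop :=
  ∀ (f : Fin m → Rd d → ℝ) (g : Rd d → ℝ), (∀ j, BCS (f j)) → BCS g →
    ∃ S : Set (Cube d), IsSparse (1/2) S ∧
      (∫⁻ x, ofFn (T f) x * ofFn g x) ≤ CT * sparseForm S f g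

/-- `‖f‖_{L^{p,∞}_u} = sup_{λ>0} λ (u^p({f > λ}))^{1/p}` for `ℝ≥0∞`-valued `f` -/
def eWeakNorm (u : Rd d → ℝ) (p : ℝ) (f : Rd d → ℝ≥0∞) : ℝ≥0∞ :=
  ⨆ (l : ℝ) (_ : 0 < l), ENNReal.ofReal l *
    (∫⁻ x in {x | ENNReal.ofReal l < f x}, ENNReal.ofReal (u x) ^ p) ^ (1/p)

def weakNorm (u : Rd d → ℝ) (p : ℝ) (f : Rd d → ℝ) : ℝ≥0∞ := eWeakNorm u p (ofFn f)

/-- `‖f‖_{L^p_u} = ‖fu‖_{L^p}` -/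
def LpW (u : Rd d → ℝ) (p : ℝ≥0∞) (f : Rd d → ℝ) : ℝ≥0∞ :=
  eLpNorm (fun x => f x * u x) p volume

lemma Cube.set_eq_pi (Q : Cube d) :
    Q.set = Set.univ.pi fun i => Ico (Q.corner i) (Q.corner i + Q.side) := by
  ext x; simp [Cube.set]

lemma Cube.measurableSet (Q : Cube d) : MeasurableSet Q.set := by
  rw [Q.set_eq_pi]
  exact MeasurableSet.univ_pi fun i => measurableSet_Ico

lemma Cube.volume_set (Q : Cube d) : volume Q.set = ENNReal.ofReal Q.side ^ d := by
  rw [Q.set_eq_pi, Real.volume_pi_Ico]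
  simp

lemma Cube.volume_ne_zero (Q : Cube d) : volume Q.set ≠ 0 := by
  rw [Q.volume_set]
  exact pow_ne_zero _ (by simpa using Q.side_pos)

lemma Cube.volume_ne_top (Q : Cube d) : volume Q.set ≠ ∞ := by
  rw [Q.volume_set]
  exact ENNReal.pow_ne_top ENNReal.ofReal_ne_top

/-- the offset, in units of the side length, of the `j`-th generation of a one-third-shifted grid -/
def shift (α : Bool) (j : ℤ) : ℝ := if α then (-1) ^ j / 3 else 0

/-- the cubes of the shifted dyadic grids -/
def gridCube (α : Fin d → Bool) (I : ℤ × (Fin d → ℤ)) : Cube d where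
  corner := fun i => (2 : ℝ) ^ (-I.1) * (I.2 i + shift (α i) I.1)
  side := (2 : ℝ) ^ (-I.1)
  side_pos := by positivity

lemma mem_gridCube {α : Fin d → Bool} {I : ℤ × (Fin d → ℤ)} {x : Rd d} :
    x ∈ (gridCube α I).set ↔ ∀ i, ⌊(2 : ℝ) ^ I.1 * x i - shift (α i) I.1⌋ = I.2 i := by
  refine forall_congr' fun i => ?_
  have h2 : (0 : ℝ) < 2 ^ I.1 := by positivity
  simp only [gridCube, Int.floor_eq_iff, zpow_neg]
  have e1 : ((2 : ℝ) ^ I.1)⁻¹ * (I.2 i + shift (α i) I.1) ≤ x i ↔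
      (I.2 i + shift (α i) I.1) ≤ 2 ^ I.1 * x i := by
    rw [inv_mul_le_iff₀ h2]
  have e2 : x i < ((2 : ℝ) ^ I.1)⁻¹ * (I.2 i + shift (α i) I.1) + (2 ^ I.1)⁻¹ ↔
      2 ^ I.1 * x i < I.2 i + shift (α i) I.1 + 1 := by
    rw [← mul_add_one, lt_inv_mul_iff₀ h2]
  rw [e1, e2]
  constructor <;> rintro ⟨h, h'⟩ <;> constructor <;> linarith

lemma exists_three_mul_shift (α : Bool) (j : ℤ) : ∃ n : ℤ, 3 * shift α j = n := by
  rcases α with _ | _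
  · exact ⟨0, by simp [shift]⟩
  · rcases Int.even_or_odd j with h | h
    · exact ⟨1, by simp [shift, h.neg_one_zpow]⟩
    · exact ⟨-1, by simp [shift, h.neg_one_zpow]; norm_num⟩

lemma shift_succ (α : Bool) (j : ℤ) : shift α (j + 1) = - shift α j := by
  rcases α with _ | _
  · simp [shift]
  · simp [shift, zpow_add₀]; ring

/-- a cell of generation `j + 1` determines the cell of generation `j` -/
lemma floor_shift_eq_div (α : Bool) (j : ℤ) : ∃ n : ℤ, ∀ x : ℝ,
    ⌊(2 : ℝ) ^ j * x - shift α j⌋ = (⌊(2 : ℝ) ^ (j + 1) * x - shift α (j + 1)⌋ + n) / 2 := by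
  obtain ⟨n, hn⟩ := exists_three_mul_shift α j
  refine ⟨-n, fun x => ?_⟩
  rw [← Int.floor_add_intCast]
  have := Int.floor_div_natCast (k := ℝ)
    ((2 : ℝ) ^ (j + 1) * x - shift α (j + 1) + ((-n : ℤ) : ℝ)) 2
  rw [Nat.cast_ofNat, Nat.cast_ofNat] at this
  rw [← this, shift_succ, zpow_add₀ two_ne_zero]
  congr 1
  push_cast
  rw [← hn]
  ring

lemma floor_shift_eq_of_le (α : Bool) {j : ℤ} {x y : ℝ} (n : ℕ)
    (h : ⌊(2 : ℝ) ^ (j + n) * x - shift α (j + n)⌋ = ⌊(2 : ℝ) ^ (j + n) * y - shift α (j + n)⌋) :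
    ⌊(2 : ℝ) ^ j * x - shift α j⌋ = ⌊(2 : ℝ) ^ j * y - shift α j⌋ := by
  induction n with
  | zero => simpa using h
  | succ n ih =>
    apply ih
    obtain ⟨k, hk⟩ := floor_shift_eq_div α (j + n)
    rw [hk, hk]
    push_cast at h
    rw [← add_assoc] at h
    rw [h]

/-- two sets are nested or disjoint -/
def NestedOrDisjoint (A B : Set (Rd d)) : Prop := A ⊆ B ∨ B ⊆ A ∨ Disjoint A B

lemma NestedOrDisjoint.symm {A B : Set (Rd d)} (h : NestedOrDisjoint A B) :
    NestedOrDisjoint B A := by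
  rcases h with h | h | h
  exacts [Or.inr (Or.inl h), Or.inl h, Or.inr (Or.inr h.symm)]

lemma gridCube_nested_of_le (α : Fin d → Bool) {I J : ℤ × (Fin d → ℤ)} (h : I.1 ≤ J.1) :
    NestedOrDisjoint (gridCube α I).set (gridCube α J).set := by
  by_cases hd : Disjoint (gridCube α I).set (gridCube α J).set
  · exact Or.inr (Or.inr hd)
  obtain ⟨x, hxI, hxJ⟩ := Set.not_disjoint_iff.1 hd
  refine Or.inr (Or.inl fun y hy => ?_)
  rw [mem_gridCube] at *
  intro i
  obtain ⟨n, hn⟩ := Int.le.dest h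
  rw [← hxI i]
  refine floor_shift_eq_of_le (α i) n ?_
  rw [hn, hy, hxJ]

lemma gridCube_nested (α : Fin d → Bool) (I J : ℤ × (Fin d → ℤ)) :
    NestedOrDisjoint (gridCube α I).set (gridCube α J).set := by
  rcases le_total I.1 J.1 with h | h
  · exact gridCube_nested_of_le α h
  · exact (gridCube_nested_of_le α h).symm

lemma exists_floor_const {z t : ℝ} (ht : t < 1 / 3) (j : ℤ) :
    ∃ (α : Bool) (k : ℤ), ∀ y, z ≤ y → y < z + t → ⌊y - shift α j⌋ = k := by
  have h1 := Int.floor_le z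
  have h2 := Int.lt_floor_add_one z
  by_cases h : z + t ≤ ⌊z⌋ + 1
  · refine ⟨false, ⌊z⌋, fun y hy hy' => ?_⟩
    rw [Int.floor_eq_iff]
    simp only [shift]
    constructor <;> simp <;> linarith
  · push Not at h
    rcases Int.even_or_odd j with hj | hj
    · refine ⟨true, ⌊z⌋, fun y hy hy' => ?_⟩
      rw [Int.floor_eq_iff]
      simp only [shift, hj.neg_one_zpow]
      constructor <;> simp <;> linarith
    · refine ⟨true, ⌊z⌋ + 1, fun y hy hy' => ?_⟩
      rw [Int.floor_eq_iff]
      simp only [shift, hj.neg_one_zpow]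
      constructor <;> simp <;> linarith

/-- the one-third trick -/
lemma exists_gridCube_superset (Q : Cube d) : ∃ (α : Fin d → Bool) (I : ℤ × (Fin d → ℤ)),
    Q.set ⊆ (gridCube α I).set ∧ (gridCube α I).side ≤ 6 * Q.side := by
  obtain ⟨n, hn1, hn2⟩ := exists_mem_Ico_zpow (x := 3 * Q.side) (y := (2 : ℝ))
    (by linarith [Q.side_pos]) (by norm_num)
  have h2 : (0 : ℝ) < 2 ^ (-(n + 1)) := by positivity
  have ht : (2 : ℝ) ^ (-(n + 1)) * Q.side < 1 / 3 := by
    rw [zpow_neg, inv_mul_lt_iff₀ (by positivity)]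
    linarith
  choose α k hk using fun i =>
    exists_floor_const (z := (2 : ℝ) ^ (-(n + 1)) * Q.corner i) ht (-(n + 1))
  refine ⟨α, (-(n + 1), k), fun x hx => ?_, ?_⟩
  · rw [mem_gridCube]
    intro i
    obtain ⟨h, h'⟩ := hx i
    apply hk
    · exact mul_le_mul_of_nonneg_left h h2.le
    · rw [← mul_add]
      exact mul_lt_mul_of_pos_left h' h2
  · simp only [gridCube, neg_neg]
    rw [zpow_add_one₀ two_ne_zero]
    linarith

lemma volume_le_of_side_le {Q R : Cube d} (h : R.side ≤ 6 * Q.side) :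
    volume R.set ≤ 6 ^ d * volume Q.set := by
  rw [Q.volume_set, R.volume_set, ← mul_pow]
  gcongr
  refine (ENNReal.ofReal_le_ofReal h).trans_eq ?_
  rw [ENNReal.ofReal_mul (by norm_num)]
  simp

/-- every finite family of pairwise nested or disjoint cubes is covered by its maximal cubes -/
lemma exists_disjoint_cover (G : Finset (Cube d))
    (hG : ∀ Q ∈ G, ∀ R ∈ G, NestedOrDisjoint Q.set R.set) :
    ∃ H ⊆ G, (H : Set (Cube d)).PairwiseDisjoint Cube.set ∧ ∀ Q ∈ G, ∃ R ∈ H, Q.set ⊆ R.set := by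
  classical
  induction G using Finset.induction_on with
  | empty => exact ⟨∅, by simp⟩
  | insert Q G hQ ih =>
    obtain ⟨H, hHG, hd, hc⟩ := ih fun A hA B hB =>
      hG A (Finset.mem_insert_of_mem hA) B (Finset.mem_insert_of_mem hB)
    by_cases h : ∃ R ∈ H, Q.set ⊆ R.set
    · refine ⟨H, hHG.trans (Finset.subset_insert _ _), hd, fun A hA => ?_⟩
      rcases Finset.mem_insert.1 hA with rfl | hA
      exacts [h, hc A hA]
    · push Not at h
      refine ⟨insert Q (H.filter fun R => ¬ R.set ⊆ Q.set),
        Finset.insert_subset_insert _ ((Finset.filter_subset _ _).trans hHG), ?_, fun A hA => ?_⟩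
      · rw [Finset.coe_insert]
        refine Set.PairwiseDisjoint.insert (hd.subset fun R hR => (Finset.mem_filter.1 hR).1)
          fun R hR _ => ?_
        rw [Finset.mem_coe, Finset.mem_filter] at hR
        rcases hG Q (Finset.mem_insert_self _ _) R (Finset.mem_insert_of_mem (hHG hR.1)) with
          h' | h' | h'
        exacts [(h R hR.1 h').elim, (hR.2 h').elim, h']
      · rcases Finset.mem_insert.1 hA with rfl | hA
        · exact ⟨A, Finset.mem_insert_self _ _, subset_rfl⟩
        · obtain ⟨R, hR, hAR⟩ := hc A hA
          by_cases hRQ : R.set ⊆ Q.set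
          · exact ⟨Q, Finset.mem_insert_self _ _, hAR.trans hRQ⟩
          · exact ⟨R, Finset.mem_insert_of_mem (Finset.mem_filter.2 ⟨hR, hRQ⟩), hAR⟩

lemma rpow_mul_measure_biUnion_le {ν : Measure (Rd d)} {a k : Cube d → ℝ≥0∞} {q : ℝ}
    {K t : ℝ≥0∞} (hq : 0 < q) (hak : ∀ R : Cube d, a R ^ q * ν R.set ≤ k R)
    (hk : ∀ H : Finset (Cube d), (H : Set (Cube d)).PairwiseDisjoint Cube.set →
      ∑ R ∈ H, k R ≤ K ^ q)
    (G : Finset (Cube d)) (hG : ∀ Q ∈ G, ∀ R ∈ G, NestedOrDisjoint Q.set R.set)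
    (ht : ∀ Q ∈ G, t ≤ a Q) :
    t ^ q * ν (⋃ Q ∈ G, Q.set) ≤ K ^ q := by
  obtain ⟨H, hHG, hd, hc⟩ := exists_disjoint_cover G hG
  have hsub : (⋃ Q ∈ G, Q.set) ⊆ ⋃ R ∈ H, R.set := by
    refine iUnion₂_subset fun Q hQ => ?_
    obtain ⟨R, hR, hQR⟩ := hc Q hQ
    exact hQR.trans (subset_biUnion_of_mem (u := Cube.set) (Finset.mem_coe.2 hR))
  calc t ^ q * ν (⋃ Q ∈ G, Q.set) ≤ t ^ q * ∑ R ∈ H, ν R.set := by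
        gcongr
        exact (measure_mono hsub).trans (measure_biUnion_finset_le _ _)
    _ ≤ ∑ R ∈ H, k R := by
        rw [Finset.mul_sum]
        refine Finset.sum_le_sum fun R hR => le_trans ?_ (hak R)
        gcongr
        exact ht R (hHG hR)
    _ ≤ K ^ q := hk H hd

lemma rpow_mul_measure_iUnion_le {ν : Measure (Rd d)} {a k : Cube d → ℝ≥0∞} {q : ℝ}
    {K t : ℝ≥0∞} (hq : 0 < q) (hak : ∀ R : Cube d, a R ^ q * ν R.set ≤ k R)
    (hk : ∀ H : Finset (Cube d), (H : Set (Cube d)).PairwiseDisjoint Cube.set →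
      ∑ R ∈ H, k R ≤ K ^ q)
    {ι : Type*} [Countable ι] (R : ι → Cube d)
    (hR : ∀ i j, NestedOrDisjoint (R i).set (R j).set) (ht : ∀ i, t ≤ a (R i)) :
    t ^ q * ν (⋃ i, (R i).set) ≤ K ^ q := by
  classical
  have hdir : Directed (· ⊆ ·) fun F : Finset ι => ⋃ i ∈ F, (R i).set :=
    Monotone.directed_le fun F F' h => biUnion_subset_biUnion_left h
  rw [Set.iUnion_eq_iUnion_finset, hdir.measure_iUnion, ENNReal.mul_iSup]
  refine iSup_le fun F => ?_
  have := rpow_mul_measure_biUnion_le hq hak hk (F.image R)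
    (by simp only [Finset.mem_image]; rintro _ ⟨i, -, rfl⟩ _ ⟨j, -, rfl⟩; exact hR i j)
    (t := t) (by simp only [Finset.mem_image]; rintro _ ⟨i, -, rfl⟩; exact ht i)
  rwa [Finset.set_biUnion_finset_image] at this

lemma sum_rpow_mul_rpow_le {ι : Type*} (H : Finset ι) (x y : ι → ℝ≥0∞) {s : ℝ} (hs0 : 0 < s)
    (hs1 : s < 1) :
    ∑ R ∈ H, x R ^ (1 - s) * y R ^ s ≤ (∑ R ∈ H, x R) ^ (1 - s) * (∑ R ∈ H, y R) ^ s := by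
  have h1 : (0 : ℝ) < 1 - s := by linarith
  have hc : (1 / (1 - s)).HolderConjugate (1 / s) := by
    rw [Real.holderConjugate_iff]
    refine ⟨by rw [lt_div_iff₀ h1]; linarith, by simp⟩
  refine (ENNReal.inner_le_Lp_mul_Lq H _ _ hc).trans_eq ?_
  simp only [← ENNReal.rpow_mul, one_div, inv_inv, mul_inv_cancel₀ h1.ne', mul_inv_cancel₀ hs0.ne',
    ENNReal.rpow_one]

/-- a Carleson condition turns sums over superlevel sets into measures of superlevel sets -/
lemma sum_superlevel_le {ν : Measure (Rd d)} {a k : Cube d → ℝ≥0∞} {q : ℝ}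
    {K : ℝ≥0∞} (hq : 0 < q) (hak : ∀ R : Cube d, a R ^ q * ν R.set ≤ k R)
    (hk : ∀ H : Finset (Cube d), (H : Set (Cube d)).PairwiseDisjoint Cube.set →
      ∑ R ∈ H, k R ≤ K ^ q)
    (hν0 : ∀ R : Cube d, ν R.set ≠ 0) (hνt : ∀ R : Cube d, ν R.set ≠ ∞)
    {E : Set (Rd d)} (G : Finset (Cube d)) (π : Cube d → Cube d)
    (hG : ∀ Q ∈ G, ∀ R ∈ G, NestedOrDisjoint (π Q).set (π R).set) {B : ℝ≥0∞}
    (hB : ∀ R : Cube d, ∀ F ⊆ G, (∀ Q ∈ F, (π Q).set ⊆ R.set) →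
      ∑ Q ∈ F, ν (π Q).set ≤ B * ν R.set)
    {t : ℝ≥0∞} (ht : ∀ Q ∈ G, t * ν (π Q).set ≤ a (π Q) * ν (E ∩ (π Q).set)) :
    t ^ (q / (1 + q)) * ∑ Q ∈ G, ν (π Q).set ≤
      B * (K ^ (q / (1 + q)) * ν E ^ (q / (1 + q))) := by
  classical
  set s := q / (1 + q) with hs
  have hs0 : 0 < s := by positivity
  have hs1 : s < 1 := by rw [hs, div_lt_one (by positivity)]; linarith
  have h1s : 0 < 1 - s := by linarith
  have hqs : q * (1 - s) = s := by rw [hs]; field_simp; ring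
  obtain ⟨H, hHG, hd, hc⟩ := exists_disjoint_cover (G.image π)
    (by simp only [Finset.mem_image]; rintro _ ⟨i, hi, rfl⟩ _ ⟨j, hj, rfl⟩; exact hG i hi j hj)
  have hc' : ∀ Q, ∃ R, Q ∈ G → R ∈ H ∧ (π Q).set ⊆ R.set := fun Q => by
    by_cases hQ : Q ∈ G
    · obtain ⟨R, h⟩ := hc (π Q) (Finset.mem_image_of_mem _ hQ)
      exact ⟨R, fun _ => h⟩
    · exact ⟨Q, fun h => (hQ h).elim⟩
  choose ρ hρ using hc'
  have hsum : ∑ Q ∈ G, ν (π Q).set ≤ B * ∑ R ∈ H, ν R.set := by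
    rw [← Finset.sum_fiberwise_of_maps_to (t := H) (g := ρ) fun Q hQ => (hρ Q hQ).1,
      Finset.mul_sum]
    refine Finset.sum_le_sum fun R hR => hB R _ (Finset.filter_subset _ _) fun Q hQ => ?_
    obtain ⟨hQG, rfl⟩ := Finset.mem_filter.1 hQ
    exact (hρ Q hQG).2
  have hterm : ∀ R ∈ H, t ^ s * ν R.set ≤ k R ^ (1 - s) * ν (E ∩ R.set) ^ s := by
    intro R hR
    obtain ⟨Q, hQ, rfl⟩ := Finset.mem_image.1 (hHG hR)
    set V := ν (π Q).set with hVdef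
    have hV : V = V ^ s * V ^ (1 - s) := by
      rw [← ENNReal.rpow_add _ _ (hν0 _) (hνt _)]; simp [hVdef]
    calc t ^ s * V = (t * V) ^ s * V ^ (1 - s) := by
          rw [ENNReal.mul_rpow_of_nonneg _ _ hs0.le, mul_assoc, ← hV]
      _ ≤ (a (π Q) * ν (E ∩ (π Q).set)) ^ s * V ^ (1 - s) := by
          exact mul_le_mul_left (ENNReal.rpow_le_rpow (ht Q hQ) hs0.le) _
      _ = (a (π Q) ^ q * V) ^ (1 - s) * ν (E ∩ (π Q).set) ^ s := by
          rw [ENNReal.mul_rpow_of_nonneg _ _ hs0.le, ENNReal.mul_rpow_of_nonneg _ _ h1s.le,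
            ← ENNReal.rpow_mul, hqs]
          ring
      _ ≤ _ := by gcongr; exact hak _
  have hE : ∑ R ∈ H, ν (E ∩ R.set) ≤ ν E := by
    have := measure_biUnion_finset (μ := ν.restrict E) hd fun R _ => R.measurableSet
    simp only [fun R : Cube d => Measure.restrict_apply (μ := ν) (s := E) R.measurableSet,
      inter_comm _ E] at this
    rw [← this]
    exact (measure_mono (subset_univ _)).trans_eq (by simp)
  calc t ^ s * ∑ Q ∈ G, ν (π Q).set ≤ t ^ s * (B * ∑ R ∈ H, ν R.set) := by gcongr
    _ = B * ∑ R ∈ H, t ^ s * ν R.set := by rw [← Finset.mul_sum]; ring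
    _ ≤ B * ∑ R ∈ H, k R ^ (1 - s) * ν (E ∩ R.set) ^ s := by
        gcongr B * ?_
        exact Finset.sum_le_sum hterm
    _ ≤ B * ((∑ R ∈ H, k R) ^ (1 - s) * (∑ R ∈ H, ν (E ∩ R.set)) ^ s) := by
        gcongr; exact sum_rpow_mul_rpow_le H _ _ hs0 hs1
    _ ≤ B * ((K ^ q) ^ (1 - s) * ν E ^ s) := by
        gcongr; exact hk H hd
    _ = B * (K ^ s * ν E ^ s) := by rw [← ENNReal.rpow_mul, hqs]

lemma lintegral_Ioc_rpow_neg {s M : ℝ} (hs1 : s < 1) (hM : 0 ≤ M) :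
    ∫⁻ τ in Ioc 0 M, ENNReal.ofReal τ ^ (-s) = ENNReal.ofReal (M ^ (1 - s) / (1 - s)) := by
  have h1 : ∫⁻ τ in Ioc 0 M, ENNReal.ofReal τ ^ (-s) =
      ∫⁻ τ in Ioc 0 M, ENNReal.ofReal (τ ^ (-s)) :=
    setLIntegral_congr_fun measurableSet_Ioc fun τ hτ => ENNReal.ofReal_rpow_of_pos hτ.1
  rw [h1, ← ofReal_integral_eq_lintegral_ofReal, ← intervalIntegral.integral_of_le hM,
    integral_rpow (Or.inl (by linarith))]
  · rw [Real.zero_rpow (by linarith)]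
    congr 1
    rw [sub_zero, neg_add_eq_sub]
  · exact (intervalIntegrable_iff_integrableOn_Ioc_of_le hM).1
      (intervalIntegral.intervalIntegrable_rpow' (by linarith))
  · exact (ae_restrict_mem measurableSet_Ioc).mono fun τ hτ => Real.rpow_nonneg hτ.1.le _

/-- the estimate for a sparse form tested on a set where the averages are at most `M` -/
lemma sum_mul_measure_inter_le {ν : Measure (Rd d)} {a k : Cube d → ℝ≥0∞} {q : ℝ}
    {K : ℝ≥0∞} (hq : 0 < q) (hak : ∀ R : Cube d, a R ^ q * ν R.set ≤ k R)
    (hk : ∀ H : Finset (Cube d), (H : Set (Cube d)).PairwiseDisjoint Cube.set →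
      ∑ R ∈ H, k R ≤ K ^ q)
    (hν0 : ∀ R : Cube d, ν R.set ≠ 0) (hνt : ∀ R : Cube d, ν R.set ≠ ∞)
    {E : Set (Rd d)} (G : Finset (Cube d)) (π : Cube d → Cube d)
    (hG : ∀ Q ∈ G, ∀ R ∈ G, NestedOrDisjoint (π Q).set (π R).set) {B : ℝ≥0∞}
    (hB : ∀ R : Cube d, ∀ F ⊆ G, (∀ Q ∈ F, (π Q).set ⊆ R.set) →
      ∑ Q ∈ F, ν (π Q).set ≤ B * ν R.set)
    {M : ℝ} (hM : 0 ≤ M)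
    (haM : ∀ Q ∈ G, a (π Q) ≤ ENNReal.ofReal M ∨ ν (E ∩ (π Q).set) = 0) :
    ∑ Q ∈ G, a (π Q) * ν (E ∩ (π Q).set) ≤
      ENNReal.ofReal (1 + q) * ENNReal.ofReal M ^ (1 / (1 + q)) *
        (B * (K ^ (q / (1 + q)) * ν E ^ (q / (1 + q)))) := by
  classical
  set s := q / (1 + q) with hs
  have hs0 : 0 < s := by positivity
  have hs1 : s < 1 := by rw [hs, div_lt_one (by positivity)]; linarith
  have h1s : 1 - s = 1 / (1 + q) := by rw [hs]; field_simp; ring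
  set c : Cube d → ℝ≥0∞ := fun Q => a (π Q) * ν (E ∩ (π Q).set) / ν (π Q).set
  have hc : ∀ Q, c Q * ν (π Q).set = a (π Q) * ν (E ∩ (π Q).set) := fun Q =>
    ENNReal.div_mul_cancel (hν0 _) (hνt _)
  have hcM : ∀ Q ∈ G, c Q ≤ ENNReal.ofReal M := by
    intro Q hQ
    rcases haM Q hQ with h | h
    · refine ENNReal.div_le_of_le_mul ?_
      gcongr
      exact inter_subset_right
    · simp [c, h]
  have hlayer : ∀ Q ∈ G, c Q = ∫⁻ τ in Ioc 0 M, (Iio (c Q).toReal).indicator 1 τ := by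
    intro Q hQ
    have hct : c Q ≠ ∞ := ne_top_of_le_ne_top ENNReal.ofReal_ne_top (hcM Q hQ)
    have hcr : (c Q).toReal ≤ M := ENNReal.toReal_le_of_le_ofReal hM (hcM Q hQ)
    rw [lintegral_indicator_one measurableSet_Iio, Measure.restrict_apply measurableSet_Iio]
    have : Iio (c Q).toReal ∩ Ioc 0 M = Ioo 0 (c Q).toReal := by
      ext τ
      simp only [mem_inter_iff, mem_Iio, mem_Ioc, mem_Ioo]
      exact ⟨fun h => ⟨h.2.1, h.1⟩, fun h => ⟨h.2, h.1, h.2.le.trans hcr⟩⟩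
    rw [this, Real.volume_Ioo, sub_zero, ENNReal.ofReal_toReal hct]
  calc ∑ Q ∈ G, a (π Q) * ν (E ∩ (π Q).set)
      = ∑ Q ∈ G, (∫⁻ τ in Ioc 0 M, (Iio (c Q).toReal).indicator 1 τ * ν (π Q).set) := by
        refine Finset.sum_congr rfl fun Q hQ => ?_
        rw [lintegral_mul_const _ (measurable_one.indicator measurableSet_Iio), ← hlayer Q hQ, hc]
    _ = ∫⁻ τ in Ioc 0 M, ∑ Q ∈ G, (Iio (c Q).toReal).indicator 1 τ * ν (π Q).set :=
        (lintegral_finsetSum _ fun Q _ =>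
          (measurable_one.indicator measurableSet_Iio).mul_const _).symm
    _ ≤ ∫⁻ τ in Ioc 0 M, ENNReal.ofReal τ ^ (-s) * (B * (K ^ s * ν E ^ s)) := by
        refine setLIntegral_mono' measurableSet_Ioc fun τ hτ => ?_
        have hτ0 : ENNReal.ofReal τ ≠ 0 := by simpa using hτ.1
        rw [ENNReal.rpow_neg, mul_comm _⁻¹, ← div_eq_mul_inv, ENNReal.le_div_iff_mul_le
          (Or.inl (by simp [hτ.1]))
          (Or.inl (ENNReal.rpow_ne_top_of_nonneg hs0.le ENNReal.ofReal_ne_top)), mul_comm]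
        have hfil : ∑ Q ∈ G, (Iio (c Q).toReal).indicator (1 : ℝ → ℝ≥0∞) τ * ν (π Q).set =
            ∑ Q ∈ G.filter (fun Q => τ < (c Q).toReal), ν (π Q).set := by
          rw [Finset.sum_filter]
          refine Finset.sum_congr rfl fun Q _ => ?_
          by_cases h : τ < (c Q).toReal <;> simp [h]
        rw [hfil]
        refine sum_superlevel_le hq hak hk hν0 hνt (G.filter (fun Q => τ < (c Q).toReal)) π
          (fun Q hQ R hR => hG Q (Finset.filter_subset _ _ hQ) R (Finset.filter_subset _ _ hR))
          (fun R F hF => hB R F (hF.trans (Finset.filter_subset _ _))) fun Q hQ => ?_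
        rw [← hc]
        gcongr
        exact ENNReal.ofReal_le_of_le_toReal (Finset.mem_filter.1 hQ).2.le
    _ = _ := by
        rw [lintegral_mul_const _ (by fun_prop), lintegral_Ioc_rpow_neg hs1 hM, h1s,
          ENNReal.ofReal_rpow_of_nonneg hM (by positivity), ← ENNReal.ofReal_mul (by positivity)]
        congr 2
        field_simp

lemma ofFn_eq_enorm (f : Rd d → ℝ) : ofFn f = fun x => ‖f x‖ₑ := by
  ext x
  rw [ofFn, ← Real.norm_eq_abs, ofReal_norm]

lemma avg_one (f : Rd d → ℝ) (Q : Cube d) :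
    avg f 1 Q = (volume Q.set)⁻¹ * ∫⁻ x in Q.set, ofFn f x := by
  simp [avg, eAvg]

lemma avg_one_mul_volume (f : Rd d → ℝ) (Q : Cube d) :
    avg f 1 Q * volume Q.set = ∫⁻ x in Q.set, ofFn f x := by
  rw [avg_one, mul_comm, ← mul_assoc, ENNReal.mul_inv_cancel Q.volume_ne_zero Q.volume_ne_top,
    one_mul]

lemma avg_one_le_of_subset {f : Rd d → ℝ} {Q R : Cube d} (h : Q.set ⊆ R.set)
    (hs : R.side ≤ 6 * Q.side) : avg f 1 Q ≤ 6 ^ d * avg f 1 R := by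
  rw [avg_one, avg_one, ← mul_assoc]
  gcongr
  have h6 : (6 ^ d : ℝ≥0∞) ≠ 0 := pow_ne_zero _ (by norm_num)
  have h6t : (6 ^ d : ℝ≥0∞) ≠ ∞ := ENNReal.pow_ne_top (by norm_num)
  rw [ENNReal.inv_le_iff_inv_le, ENNReal.mul_inv (Or.inl h6) (Or.inl h6t), inv_inv, mul_comm,
    ← div_eq_mul_inv]
  exact ENNReal.div_le_of_le_mul ((volume_le_of_side_le hs).trans_eq (mul_comm _ _))

/-- the measure with density `u` -/
def weightMeasure (u : Rd d → ℝ) : Measure (Rd d) :=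
  volume.withDensity fun x => ENNReal.ofReal (u x)

lemma weightMeasure_apply (u : Rd d → ℝ) {A : Set (Rd d)} (hA : MeasurableSet A) :
    weightMeasure u A = wMeas u A := by
  rw [weightMeasure, withDensity_apply _ hA, wMeas]

lemma mul_volume_le_setLIntegral_maximal {u : Rd d → ℝ} (hu : ∀ᵐ x, 0 < u x) {A : Set (Rd d)}
    (hA : MeasurableSet A) {P R : Cube d} (hAP : A ⊆ P.set) (hPR : P.set ⊆ R.set) :
    (volume P.set)⁻¹ * weightMeasure u P.set * volume A ≤
      ∫⁻ x in A, maximal (R.set.indicator u) x := by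
  rw [← setLIntegral_const]
  refine setLIntegral_mono' hA fun x hx => ?_
  refine le_trans ?_ (le_iSup₂ (f := fun (Q : Cube d) (_ : x ∈ Q.set) =>
    avg (R.set.indicator u) 1 Q) P (hAP hx))
  rw [avg_one, weightMeasure_apply u P.measurableSet, wMeas]
  gcongr 1
  refine lintegral_mono_ae ?_
  filter_upwards [ae_restrict_of_ae hu, ae_restrict_mem P.measurableSet] with y hy hyP
  rw [ofFn, indicator_of_mem (hPR hyP), abs_of_pos hy]

lemma setLIntegral_maximal_le {u : Rd d → ℝ} (hν0 : ∀ R : Cube d, weightMeasure u R.set ≠ 0)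
    (hνt : ∀ R : Cube d, weightMeasure u R.set ≠ ∞) (R : Cube d) :
    ∫⁻ x in R.set, maximal (R.set.indicator u) x ≤ FW u * weightMeasure u R.set := by
  have h := le_iSup (fun Q : Cube d =>
    (wMeas u Q.set)⁻¹ * ∫⁻ x in Q.set, maximal (Q.set.indicator u) x) R
  rw [← weightMeasure_apply u R.measurableSet, mul_comm,
    ENNReal.mul_inv_le_iff (hν0 R) (hνt R)] at h
  exact h

lemma FW_ne_zero {u : Rd d → ℝ} (hu : ∀ᵐ x, 0 < u x)
    (hν0 : ∀ R : Cube d, weightMeasure u R.set ≠ 0)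
    (hνt : ∀ R : Cube d, weightMeasure u R.set ≠ ∞) : FW u ≠ 0 := by
  intro h
  let R : Cube d := ⟨0, 1, one_pos⟩
  have h1 := setLIntegral_maximal_le hν0 hνt R
  have h2 := mul_volume_le_setLIntegral_maximal hu R.measurableSet subset_rfl (subset_rfl (a := R.set))
  rw [h, zero_mul] at h1
  have := h2.trans h1
  simp [hν0 R, R.volume_ne_zero, R.volume_ne_top] at this

lemma sum_weightMeasure_le {u : Rd d → ℝ} (hu : ∀ᵐ x, 0 < u x)
    (hν0 : ∀ R : Cube d, weightMeasure u R.set ≠ 0)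
    (hνt : ∀ R : Cube d, weightMeasure u R.set ≠ ∞)
    {S : Set (Cube d)} (hS : IsSparse (1 / 2) S) {π : Cube d → Cube d}
    (hπ : ∀ Q, Q.set ⊆ (π Q).set) (hπs : ∀ Q, (π Q).side ≤ 6 * Q.side)
    (R : Cube d) (F : Finset (Cube d)) (hF : ∀ Q ∈ F, Q ∈ S)
    (hFR : ∀ Q ∈ F, (π Q).set ⊆ R.set) :
    ∑ Q ∈ F, weightMeasure u (π Q).set ≤ 2 * 6 ^ d * FW u * weightMeasure u R.set := by
  obtain ⟨E, hE, hd⟩ := hS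
  calc ∑ Q ∈ F, weightMeasure u (π Q).set
      ≤ ∑ Q ∈ F, 2 * 6 ^ d * ∫⁻ x in E Q, maximal (R.set.indicator u) x := by
        refine Finset.sum_le_sum fun Q hQ => ?_
        obtain ⟨h1, h2, h3⟩ := hE Q (hF Q hQ)
        have h4 : volume (π Q).set ≤ 2 * 6 ^ d * volume (E Q) := by
          calc volume (π Q).set ≤ 6 ^ d * volume Q.set := volume_le_of_side_le (hπs Q)
            _ = 2 * 6 ^ d * (ENNReal.ofReal (1 / 2) * volume Q.set) := by
                have : (2 : ℝ≥0∞) * ENNReal.ofReal (1 / 2) = 1 := by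
                  rw [← ENNReal.ofReal_ofNat, ← ENNReal.ofReal_mul (by norm_num)]; simp
                calc 6 ^ d * volume Q.set
                    = (2 * ENNReal.ofReal (1 / 2)) * (6 ^ d * volume Q.set) := by
                      rw [this, one_mul]
                  _ = _ := by ring
            _ ≤ _ := by gcongr
        calc weightMeasure u (π Q).set
            = (volume (π Q).set)⁻¹ * weightMeasure u (π Q).set * volume (π Q).set := by
              rw [mul_right_comm, ENNReal.inv_mul_cancel (π Q).volume_ne_zero
                (π Q).volume_ne_top, one_mul]
          _ ≤ (volume (π Q).set)⁻¹ * weightMeasure u (π Q).set * (2 * 6 ^ d * volume (E Q)) := by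
              gcongr
          _ = 2 * 6 ^ d * ((volume (π Q).set)⁻¹ * weightMeasure u (π Q).set * volume (E Q)) := by
              ring
          _ ≤ _ := by
              gcongr
              exact mul_volume_le_setLIntegral_maximal hu h2 (h1.trans (hπ Q)) (hFR Q hQ)
    _ = 2 * 6 ^ d * ∫⁻ x in ⋃ Q ∈ F, E Q, maximal (R.set.indicator u) x := by
        rw [lintegral_biUnion_finset (hd.subset hF) fun Q hQ => (hE Q (hF Q hQ)).2.1,
          Finset.mul_sum]
    _ ≤ 2 * 6 ^ d * ∫⁻ x in R.set, maximal (R.set.indicator u) x := by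
        gcongr
        exact iUnion₂_subset fun Q hQ => (hE Q (hF Q hQ)).1.trans ((hπ Q).trans (hFR Q hQ))
    _ ≤ 2 * 6 ^ d * (FW u * weightMeasure u R.set) := by
        gcongr
        exact setLIntegral_maximal_le hν0 hνt R
    _ = _ := by ring

lemma eLpNorm_restrict_eq_avgE (h : Rd d → ℝ) {q : ℝ≥0∞} (hq : q ≠ 0) (R : Cube d) :
    eLpNorm h q (volume.restrict R.set) = volume R.set ^ (q⁻¹).toReal * avgE h q R := by
  by_cases hqt : q = ∞
  · subst hqt
    simp [avgE, eLpNormEssSup, ofFn_eq_enorm]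
  · have hpos : 0 < q.toReal := ENNReal.toReal_pos hq hqt
    rw [avgE, if_neg hqt, avg, eAvg, eLpNorm_eq_lintegral_rpow_enorm_toReal hq hqt,
      ENNReal.mul_rpow_of_nonneg _ _ (by positivity), ← mul_assoc, ENNReal.inv_rpow,
      ENNReal.toReal_inv, one_div, ENNReal.mul_inv_cancel, one_mul, ofFn_eq_enorm]
    · simp [ENNReal.rpow_eq_zero_iff, R.volume_ne_zero, R.volume_ne_top]
    · exact ENNReal.rpow_ne_top_of_nonneg (by positivity) R.volume_ne_top

lemma conj_ne_zero {p : ℝ≥0∞} : conj p ≠ 0 := by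
  rw [conj]
  exact ENNReal.inv_ne_zero.2 (ne_top_of_le_ne_top ENNReal.one_ne_top tsub_le_self)

lemma avg_one_le_mul_avgE {f w : Rd d → ℝ} (hf : Measurable f) (hw : IsWeight w) {p : ℝ≥0∞}
    (hp : 1 ≤ p) (R : Cube d) :
    avg f 1 R ≤ volume R.set ^ (-(p⁻¹).toReal) *
      (eLpNorm (fun x => f x * w x) p (volume.restrict R.set) *
        avgE (fun x => (w x)⁻¹) (conj p) R) := by
  have hp1 : p⁻¹ ≤ 1 := ENNReal.inv_le_one.2 hp
  have : ENNReal.HolderTriple (conj p) p 1 := ⟨by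
    rw [conj, inv_inv, inv_one, tsub_add_cancel_of_le hp1]⟩
  have hwm : AEStronglyMeasurable w (volume.restrict R.set) :=
    hw.1.aestronglyMeasurable.restrict
  have key : ∫⁻ x in R.set, ofFn f x ≤
      eLpNorm (fun x => (w x)⁻¹) (conj p) (volume.restrict R.set) *
        eLpNorm (fun x => f x * w x) p (volume.restrict R.set) := by
    refine le_trans (le_of_eq ?_) (eLpNorm_smul_le_mul_eLpNorm (r := 1)
      (hf.aestronglyMeasurable.mul hwm) (φ := fun x => (w x)⁻¹) hwm.aemeasurable.inv.aestronglyMeasurable)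
    rw [eLpNorm_one_eq_lintegral_enorm, ofFn_eq_enorm]
    refine lintegral_congr_ae ?_
    filter_upwards [ae_restrict_of_ae hw.2] with x hx
    have : (w x)⁻¹ • (f x * w x) = f x := by
      rw [smul_eq_mul]; field_simp
    simp only [Pi.smul_apply', Pi.mul_apply]
    rw [this]
  rw [eLpNorm_restrict_eq_avgE _ conj_ne_zero, conj, inv_inv, ENNReal.toReal_sub_of_le hp1
    ENNReal.one_ne_top, ENNReal.toReal_one, ENNReal.rpow_sub _ _ R.volume_ne_zero R.volume_ne_top,
    ENNReal.rpow_one] at key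
  rw [avg_one]
  refine (mul_le_mul_right key _).trans_eq ?_
  rw [ENNReal.rpow_neg, ENNReal.div_eq_inv_mul, conj]
  calc _ = ((volume R.set)⁻¹ * volume R.set) * ((volume R.set ^ (p⁻¹).toReal)⁻¹ * 
      (eLpNorm (fun x => f x * w x) p (volume.restrict R.set) *
        avgE (fun x => (w x)⁻¹) (1 - p⁻¹)⁻¹ R)) := by ring
    _ = _ := by rw [ENNReal.inv_mul_cancel R.volume_ne_zero R.volume_ne_top, one_mul]

lemma prod_rpow_eq_rpow_sum {ι : Type*} (s : Finset ι) (x : ι → ℝ) {V : ℝ≥0∞} (h0 : V ≠ 0)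
    (ht : V ≠ ∞) : ∏ i ∈ s, V ^ x i = V ^ ∑ i ∈ s, x i := by
  classical
  induction s using Finset.induction_on with
  | empty => simp
  | insert a s ha ih => rw [Finset.prod_insert ha, Finset.sum_insert ha, ih,
      ENNReal.rpow_add _ _ h0 ht]

lemma avgE_inv_ne_zero {w : Rd d → ℝ} (hw : IsWeight w) (q : ℝ≥0∞) (hq : q ≠ 0) (R : Cube d) :
    avgE (fun x => (w x)⁻¹) q R ≠ 0 := by
  intro h
  have h0 := eLpNorm_restrict_eq_avgE (fun x => (w x)⁻¹) hq R
  have hwm : AEStronglyMeasurable (fun x => (w x)⁻¹) (volume.restrict R.set) :=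
    hw.1.aestronglyMeasurable.restrict.aemeasurable.inv.aestronglyMeasurable
  rw [h, mul_zero, eLpNorm_eq_zero_iff hwm hq] at h0
  have hf : ∀ᵐ x ∂volume.restrict R.set, False := by
    filter_upwards [ae_restrict_of_ae hw.2, h0] with x hx hx0
    exact (inv_pos.2 hx).ne' hx0
  have : volume R.set = 0 := by simpa using hf
  exact R.volume_ne_zero this

lemma sum_prod_eLpNorm_rpow_le {p : Fin m → ℝ≥0∞} (hp : ∀ j, 1 ≤ p j) {p0 : ℝ≥0∞}
    (hp00 : p0 ≠ 0) (hp0top : p0 ≠ ∞) (hp0 : p0⁻¹ = ∑ j, (p j)⁻¹) (h : Fin m → Rd d → ℝ)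
    (H : Finset (Cube d)) (hd : (H : Set (Cube d)).PairwiseDisjoint Cube.set) :
    ∑ R ∈ H, (∏ j, eLpNorm (h j) (p j) (volume.restrict R.set)) ^ p0.toReal ≤
      (∏ j, eLpNorm (h j) (p j) volume) ^ p0.toReal := by
  set q := p0.toReal
  have hq : 0 < q := ENNReal.toReal_pos hp00 hp0top
  set x : Fin m → Cube d → ℝ≥0∞ := fun j R =>
    if p j = ∞ then 1 else ∫⁻ y in R.set, ‖h j y‖ₑ ^ (p j).toReal
  set A : Fin m → ℝ≥0∞ := fun j => if p j = ∞ then eLpNorm (h j) (p j) volume ^ q else 1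
  set θ : Fin m → ℝ := fun j => q * ((p j)⁻¹).toReal with hθ
  have hθ0 : ∀ j, 0 ≤ θ j := fun j => by positivity
  have hθ1 : ∑ j, θ j = 1 := by
    rw [← Finset.mul_sum, ← ENNReal.toReal_sum, ← hp0, ENNReal.toReal_inv, mul_inv_cancel₀ hq.ne']
    intro j _
    exact ne_top_of_le_ne_top ENNReal.one_ne_top (ENNReal.inv_le_one.2 (hp j))
  have h1 : ∀ j R, eLpNorm (h j) (p j) (volume.restrict R.set) ^ q ≤ A j * x j R ^ θ j := by
    intro j R
    by_cases hj : p j = ∞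
    · simp only [A, x, hθ, if_pos hj, ENNReal.one_rpow, mul_one]
      gcongr
      exact Measure.restrict_le_self
    · simp only [A, x, hθ, if_neg hj, one_mul]
      rw [eLpNorm_eq_lintegral_rpow_enorm_toReal (zero_lt_one.trans_le (hp j)).ne' hj,
        ← ENNReal.rpow_mul, ENNReal.toReal_inv, mul_comm q, one_div]
  have h2 : ∀ j, A j * (∑ R ∈ H, x j R) ^ θ j ≤ eLpNorm (h j) (p j) volume ^ q := by
    intro j
    by_cases hj : p j = ∞
    · simp [A, hθ, hj]
    · simp only [A, x, hθ, if_neg hj, one_mul]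
      rw [eLpNorm_eq_lintegral_rpow_enorm_toReal (zero_lt_one.trans_le (hp j)).ne' hj,
        ← ENNReal.rpow_mul, ENNReal.toReal_inv, mul_comm q, one_div,
        ← lintegral_biUnion_finset hd fun R _ => R.measurableSet]
      gcongr
      exact Measure.restrict_le_self
  let _ : MeasurableSpace H := ⊤
  have h3 := ENNReal.lintegral_prod_norm_pow_le (μ := (Measure.count : Measure H))
    Finset.univ (f := fun j (R : H) => x j R) (fun j _ => (measurable_of_finite _).aemeasurable) hθ1
    fun j _ => hθ0 j
  simp only [lintegral_count, tsum_fintype] at h3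
  rw [Finset.sum_coe_sort H (fun R => ∏ j, x j R ^ θ j)] at h3
  simp only [fun j => Finset.sum_coe_sort H (fun R => x j R)] at h3
  simp only [← ENNReal.prod_rpow_of_nonneg hq.le]
  calc _ ≤ ∑ R ∈ H, ∏ j, A j * x j R ^ θ j :=
        Finset.sum_le_sum fun R _ => Finset.prod_le_prod' fun j _ => h1 j R
    _ = (∏ j, A j) * ∑ R ∈ H, ∏ j, x j R ^ θ j := by
        simp only [Finset.prod_mul_distrib, Finset.mul_sum]
    _ ≤ (∏ j, A j) * ∏ j, (∑ R ∈ H, x j R) ^ θ j := by gcongr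
    _ = ∏ j, A j * (∑ R ∈ H, x j R) ^ θ j := Finset.prod_mul_distrib.symm
    _ ≤ _ := Finset.prod_le_prod' fun j _ => h2 j

lemma aemeasurable_prodW {w : Fin m → Rd d → ℝ} (hw : ∀ j, IsWeight (w j)) :
    AEMeasurable (prodW w) volume := by
  refine (Finset.univ.aemeasurable_prod fun j _ =>
    (hw j).1.aestronglyMeasurable.aemeasurable).congr (ae_of_all _ fun x => ?_)
  simp [prodW]

lemma prodW_pos {w : Fin m → Rd d → ℝ} (hw : ∀ j, IsWeight (w j)) : ∀ᵐ x, 0 < prodW w x := by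
  filter_upwards [ae_all_iff.2 fun j => (hw j).2] with x hx
  exact Finset.prod_pos fun j _ => hx j

lemma weightMeasure_ne_zero {u : Rd d → ℝ} (hum : AEMeasurable u volume) (hu : ∀ᵐ x, 0 < u x)
    (R : Cube d) : weightMeasure u R.set ≠ 0 := by
  rw [weightMeasure_apply u R.measurableSet, wMeas]
  intro h
  rw [lintegral_eq_zero_iff' hum.restrict.ennreal_ofReal] at h
  have hf : ∀ᵐ x ∂volume.restrict R.set, False := by
    filter_upwards [ae_restrict_of_ae hu, h] with x hx hx0
    exact (ENNReal.ofReal_pos.2 hx).ne' hx0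
  exact R.volume_ne_zero (by simpa using hf)

lemma weightMeasure_rpow_eq {w : Fin m → Rd d → ℝ} (hw : ∀ j, IsWeight (w j)) {q : ℝ}
    {A : Set (Rd d)} (hA : MeasurableSet A) :
    weightMeasure (fun x => prodW w x ^ q) A = ∫⁻ x in A, ENNReal.ofReal (prodW w x) ^ q := by
  rw [weightMeasure_apply _ hA, wMeas]
  refine lintegral_congr_ae ?_
  filter_upwards [ae_restrict_of_ae (prodW_pos hw)] with x hx
  rw [ENNReal.ofReal_rpow_of_pos hx]

lemma weightMeasure_eq_volume_mul_avg {w : Fin m → Rd d → ℝ} (hw : ∀ j, IsWeight (w j)) {q : ℝ}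
    (hq : 0 < q) (R : Cube d) :
    weightMeasure (fun x => prodW w x ^ q) R.set = volume R.set * avg (prodW w) q R ^ q := by
  rw [weightMeasure_rpow_eq hw R.measurableSet, avg, eAvg, one_div, ENNReal.rpow_inv_rpow hq.ne',
    ← mul_assoc, ENNReal.mul_inv_cancel R.volume_ne_zero R.volume_ne_top, one_mul]
  refine lintegral_congr_ae ?_
  filter_upwards [ae_restrict_of_ae (prodW_pos hw)] with x hx
  rw [ofFn, abs_of_pos hx]

lemma avg_mul_prod_le_AP (q : ℝ) (p : Fin m → ℝ≥0∞) (w : Fin m → Rd d → ℝ) (R : Cube d) :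
    avg (prodW w) q R * ∏ j, avgE (fun x => (w j x)⁻¹) (conj (p j)) R ≤ AP q p w :=
  le_iSup (fun Q : Cube d =>
    avg (prodW w) q Q * ∏ j, avgE (fun x => (w j x)⁻¹) (conj (p j)) Q) R

lemma weightMeasure_ne_top {w : Fin m → Rd d → ℝ} (hw : ∀ j, IsWeight (w j)) {q : ℝ} (hq : 0 < q)
    {p : Fin m → ℝ≥0∞} (hAP : AP q p w ≠ ∞) (R : Cube d) :
    weightMeasure (fun x => prodW w x ^ q) R.set ≠ ∞ := by
  rw [weightMeasure_eq_volume_mul_avg hw hq]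
  refine ENNReal.mul_ne_top R.volume_ne_top (ENNReal.rpow_ne_top_of_nonneg hq.le fun h => ?_)
  have := avg_mul_prod_le_AP q p w R
  rw [h, ENNReal.top_mul (Finset.prod_ne_zero_iff.2 fun j _ =>
    avgE_inv_ne_zero (hw j) _ conj_ne_zero R)] at this
  exact hAP (top_le_iff.1 this)

lemma prod_avg_rpow_mul_weightMeasure_le {p : Fin m → ℝ≥0∞} (hp : ∀ j, 1 ≤ p j) {p0 : ℝ≥0∞}
    (hp00 : p0 ≠ 0) (hp0top : p0 ≠ ∞) (hp0 : p0⁻¹ = ∑ j, (p j)⁻¹)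
    {w : Fin m → Rd d → ℝ} (hw : ∀ j, IsWeight (w j)) {f : Fin m → Rd d → ℝ}
    (hf : ∀ j, Measurable (f j)) (R : Cube d) :
    (∏ j, avg (f j) 1 R) ^ p0.toReal * weightMeasure (fun x => prodW w x ^ p0.toReal) R.set ≤
      (AP p0.toReal p w *
        ∏ j, eLpNorm (fun x => f j x * w j x) (p j) (volume.restrict R.set)) ^ p0.toReal := by
  set q := p0.toReal with hqdef
  have hq : 0 < q := ENNReal.toReal_pos hp00 hp0top
  have hV0 := R.volume_ne_zero
  have hVt := R.volume_ne_top
  have hsum : ∑ j, -((p j)⁻¹).toReal = -q⁻¹ := by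
    rw [Finset.sum_neg_distrib, ← ENNReal.toReal_sum, ← hp0, ENNReal.toReal_inv]
    intro j _
    exact ne_top_of_le_ne_top ENNReal.one_ne_top (ENNReal.inv_le_one.2 (hp j))
  set N := ∏ j, eLpNorm (fun x => f j x * w j x) (p j) (volume.restrict R.set)
  set A := ∏ j, avgE (fun x => (w j x)⁻¹) (conj (p j)) R
  have h1 : ∏ j, avg (f j) 1 R ≤ volume R.set ^ (-q⁻¹) * (N * A) := by
    rw [← hsum, ← prod_rpow_eq_rpow_sum _ _ hV0 hVt, ← Finset.prod_mul_distrib,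
      ← Finset.prod_mul_distrib]
    exact Finset.prod_le_prod' fun j _ => avg_one_le_mul_avgE (hf j) (hw j) (hp j) R
  calc _ ≤ (volume R.set ^ (-q⁻¹) * (N * A)) ^ q * (volume R.set * avg (prodW w) q R ^ q) := by
        rw [weightMeasure_eq_volume_mul_avg hw hq]
        gcongr
    _ = ((volume R.set)⁻¹ * volume R.set) * (avg (prodW w) q R * A * N) ^ q := by
        rw [ENNReal.mul_rpow_of_nonneg _ _ hq.le, ← ENNReal.rpow_mul, neg_mul,
          inv_mul_cancel₀ hq.ne', ENNReal.rpow_neg_one]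
        simp only [ENNReal.mul_rpow_of_nonneg _ _ hq.le]
        ring
    _ = (avg (prodW w) q R * A * N) ^ q := by rw [ENNReal.inv_mul_cancel hV0 hVt, one_mul]
    _ ≤ _ := by
        gcongr
        exact avg_mul_prod_le_AP q p w R

/-- testing sparse form domination against the weight restricted to a set -/
lemma mul_weightMeasure_le_of_sparse {T : (Fin m → Rd d → ℝ) → Rd d → ℝ} {CT : ℝ≥0∞}
    (hT : SparseFormDom T CT) {f : Fin m → Rd d → ℝ} (hf : ∀ j, BCS (f j))
    {u v : Rd d → ℝ} (hv : Measurable v) (huv : u =ᵐ[volume] v) (hu : ∀ᵐ x, 0 < u x)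
    {E : Set (Rd d)} (hE : MeasurableSet E) {N : ℝ} (hEN : ∀ x ∈ E, |v x| ≤ N)
    (hEb : E ⊆ Metric.closedBall 0 N) {l : ℝ≥0∞} (hl : ∀ x ∈ E, l ≤ ofFn (T f) x)
    {X : ℝ≥0∞} (hX : ∀ S : Set (Cube d), IsSparse (1 / 2) S → ∀ F : Finset (Cube d),
      (∀ Q ∈ F, Q ∈ S) →
      ∑ Q ∈ F, (∏ j, avg (f j) 1 Q) * weightMeasure u (E ∩ Q.set) ≤ X) :
    l * weightMeasure u E ≤ CT * X := by
  classical
  have hofg : ofFn (E.indicator v) = E.indicator (ofFn v) := by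
    ext x
    by_cases hx : x ∈ E <;> simp [ofFn, hx]
  have hof : ofFn v =ᵐ[volume] fun x => ENNReal.ofReal (u x) := by
    filter_upwards [huv, hu] with x h1 h2
    rw [ofFn, ← h1, abs_of_pos h2]
  have hmeas : ∀ A, MeasurableSet A → ∫⁻ x in A, ofFn (E.indicator v) x =
      weightMeasure u (E ∩ A) := by
    intro A hA
    rw [hofg, setLIntegral_indicator hE, weightMeasure_apply u (hE.inter hA), wMeas]
    exact lintegral_congr_ae (ae_restrict_of_ae hof)
  have hg : BCS (E.indicator v) := by
    refine ⟨hv.indicator hE, ⟨|N|, fun x => ?_⟩, ?_⟩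
    · by_cases hx : x ∈ E
      · rw [indicator_of_mem hx]; exact (hEN x hx).trans (le_abs_self N)
      · simp [indicator_of_notMem hx]
    · exact HasCompactSupport.intro (isCompact_closedBall 0 N) fun x hx =>
        indicator_of_notMem (fun h => hx (hEb h)) _
  obtain ⟨S, hS, hdom⟩ := hT f _ hf hg
  have hform : sparseForm S f (E.indicator v) ≤ X := by
    rw [sparseForm, ENNReal.tsum_eq_iSup_sum]
    refine iSup_le fun F => ?_
    refine le_trans (le_of_eq ?_) (hX S hS (F.map (Function.Embedding.subtype _)) ?_)
    · rw [Finset.sum_map]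
      refine Finset.sum_congr rfl fun Q _ => ?_
      rw [mul_assoc, avg_one_mul_volume, hmeas _ Q.1.measurableSet]
      rfl
    · simp only [Finset.mem_map]
      rintro _ ⟨Q, -, rfl⟩
      exact Q.2
  calc l * weightMeasure u E = ∫⁻ x in E, l * ENNReal.ofReal (u x) := by
        rw [weightMeasure_apply u hE, wMeas, lintegral_const_mul'']
        exact (hv.aemeasurable.congr huv.symm).restrict.ennreal_ofReal
    _ ≤ ∫⁻ x in E, ofFn (T f) x * ofFn (E.indicator v) x := by
        refine lintegral_mono_ae ?_
        filter_upwards [ae_restrict_mem hE, ae_restrict_of_ae hof] with x hx h1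
        rw [hofg, indicator_of_mem hx, h1]
        gcongr
        exact hl x hx
    _ ≤ ∫⁻ x, ofFn (T f) x * ofFn (E.indicator v) x := setLIntegral_le_lintegral _ _
    _ ≤ CT * sparseForm S f (E.indicator v) := hdom
    _ ≤ CT * X := by gcongr

/-- the constant in the weak-type estimate -/
def weakConst (d m : ℕ) (q : ℝ) : ℝ≥0∞ :=
  2 * (6 ^ d) ^ m * 2 ^ d * ENNReal.ofReal (1 + q) * (2 * 6 ^ d) *
    ((2 ^ (d + 1)) ^ (1 / q)) ^ (1 / (1 + q))

lemma weakConst_ne_top (d m : ℕ) {q : ℝ} (hq : 0 < q) : weakConst d m q ≠ ∞ := by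
  have h2 : (2 : ℝ≥0∞) ≠ ∞ := by norm_num
  have h6 : (6 ^ d : ℝ≥0∞) ≠ ∞ := ENNReal.pow_ne_top (by norm_num)
  unfold weakConst
  refine ENNReal.mul_ne_top (ENNReal.mul_ne_top (ENNReal.mul_ne_top (ENNReal.mul_ne_top
    (ENNReal.mul_ne_top h2 (ENNReal.pow_ne_top h6)) (ENNReal.pow_ne_top h2)) ENNReal.ofReal_ne_top)
    (ENNReal.mul_ne_top h2 h6)) ?_
  exact ENNReal.rpow_ne_top_of_nonneg (by positivity)
    (ENNReal.rpow_ne_top_of_nonneg (by positivity) (ENNReal.pow_ne_top h2))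

lemma weakConst_balance (d m : ℕ) {q : ℝ} (hq : 0 < q) {B K e : ℝ≥0∞}
    (hK0 : K ≠ 0) (hKt : K ≠ ∞) (he0 : e ≠ 0) (het : e ≠ ∞) :
    2 * ((6 ^ d) ^ m * (2 ^ d * (ENNReal.ofReal (1 + q) *
      ((2 ^ (d + 1)) ^ (1 / q) * K * e ^ (-(1 / q))) ^ (1 / (1 + q)) *
        (2 * 6 ^ d * B * (K ^ (q / (1 + q)) * e ^ (q / (1 + q))))))) * e ^ (1 / q - 1) =
      weakConst d m q * B * K := by
  have h1q : 0 ≤ 1 / (1 + q) := by positivity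
  have hK : K ^ (1 / (1 + q)) * K ^ (q / (1 + q)) = K := by
    rw [← ENNReal.rpow_add _ _ hK0 hKt, ← add_div, div_self (by positivity), ENNReal.rpow_one]
  have he : e ^ (-(1 / q) * (1 / (1 + q))) * e ^ (q / (1 + q)) * e ^ (1 / q - 1) = 1 := by
    rw [← ENNReal.rpow_add _ _ he0 het, ← ENNReal.rpow_add _ _ he0 het]
    convert ENNReal.rpow_zero
    field_simp
    ring
  rw [ENNReal.mul_rpow_of_nonneg _ _ h1q, ENNReal.mul_rpow_of_nonneg _ _ h1q,
    ← ENNReal.rpow_mul e, weakConst]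
  calc _ = 2 * (6 ^ d) ^ m * 2 ^ d * ENNReal.ofReal (1 + q) * (2 * 6 ^ d) *
        ((2 ^ (d + 1)) ^ (1 / q)) ^ (1 / (1 + q)) * B * (K ^ (1 / (1 + q)) * K ^ (q / (1 + q))) *
        (e ^ (-(1 / q) * (1 / (1 + q))) * e ^ (q / (1 + q)) * e ^ (1 / q - 1)) := by ring
    _ = _ := by rw [hK, he, mul_one]

lemma sum_prod_avg_mul_le {u : Rd d → ℝ} (hu : ∀ᵐ x, 0 < u x)
    (hν0 : ∀ R : Cube d, weightMeasure u R.set ≠ 0)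
    (hνt : ∀ R : Cube d, weightMeasure u R.set ≠ ∞)
    {f : Fin m → Rd d → ℝ} {k : Cube d → ℝ≥0∞} {q : ℝ} {K : ℝ≥0∞} (hq : 0 < q)
    (hak : ∀ R : Cube d, (∏ j, avg (f j) 1 R) ^ q * weightMeasure u R.set ≤ k R)
    (hk : ∀ H : Finset (Cube d), (H : Set (Cube d)).PairwiseDisjoint Cube.set →
      ∑ R ∈ H, k R ≤ K ^ q)
    {E : Set (Rd d)} {M : ℝ} (hM : 0 ≤ M)
    (hEM : ∀ (α : Fin d → Bool) I, ∏ j, avg (f j) 1 (gridCube α I) ≤ ENNReal.ofReal M ∨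
      E ∩ (gridCube α I).set = ∅)
    {S : Set (Cube d)} (hS : IsSparse (1 / 2) S) (F : Finset (Cube d)) (hF : ∀ Q ∈ F, Q ∈ S) :
    ∑ Q ∈ F, (∏ j, avg (f j) 1 Q) * weightMeasure u (E ∩ Q.set) ≤
      (6 ^ d) ^ m * (2 ^ d * (ENNReal.ofReal (1 + q) * ENNReal.ofReal M ^ (1 / (1 + q)) *
        (2 * 6 ^ d * FW u * (K ^ (q / (1 + q)) * weightMeasure u E ^ (q / (1 + q)))))) := by
  classical
  choose α I hsub hside using fun Q : Cube d => exists_gridCube_superset Q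
  set π : Cube d → Cube d := fun Q => gridCube (α Q) (I Q)
  have hα : ∀ β : Fin d → Bool,
      ∑ Q ∈ F with α Q = β, (∏ j, avg (f j) 1 (π Q)) * weightMeasure u (E ∩ (π Q).set) ≤
      ENNReal.ofReal (1 + q) * ENNReal.ofReal M ^ (1 / (1 + q)) *
        (2 * 6 ^ d * FW u * (K ^ (q / (1 + q)) * weightMeasure u E ^ (q / (1 + q)))) := by
    intro β
    refine sum_mul_measure_inter_le (a := fun R => ∏ j, avg (f j) 1 R) hq hak hk hν0 hνt _ π
      (fun Q hQ R hR => ?_) (fun R G hG hGR => ?_) hM fun Q _ => ?_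
    · have h1 := (Finset.mem_filter.1 hQ).2
      have h2 := (Finset.mem_filter.1 hR).2
      simp only [π, h1, h2]
      exact gridCube_nested β _ _
    · exact sum_weightMeasure_le hu hν0 hνt hS hsub hside R G
        (fun Q hQ => hF Q (Finset.filter_subset _ _ (hG hQ))) hGR
    · exact (hEM (α Q) (I Q)).imp_right fun h => by simp only [π, h, measure_empty]
  calc _ ≤ ∑ Q ∈ F, (6 ^ d) ^ m *
          ((∏ j, avg (f j) 1 (π Q)) * weightMeasure u (E ∩ (π Q).set)) := by
        refine Finset.sum_le_sum fun Q _ => ?_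
        rw [← mul_assoc]
        gcongr
        · calc ∏ j, avg (f j) 1 Q ≤ ∏ j, 6 ^ d * avg (f j) 1 (π Q) :=
                Finset.prod_le_prod' fun j _ => avg_one_le_of_subset (hsub Q) (hside Q)
            _ = _ := by simp [Finset.prod_mul_distrib]
        · exact hsub Q
    _ = (6 ^ d) ^ m * ∑ β, ∑ Q ∈ F with α Q = β,
          (∏ j, avg (f j) 1 (π Q)) * weightMeasure u (E ∩ (π Q).set) := by
        rw [← Finset.mul_sum, Finset.sum_fiberwise]
    _ ≤ _ := by
        gcongr
        refine (Finset.sum_le_sum fun β _ => hα β).trans_eq ?_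
        simp

lemma mul_weightMeasure_rpow_le {T : (Fin m → Rd d → ℝ) → Rd d → ℝ} {CT : ℝ≥0∞}
    (hT : SparseFormDom T CT) {f : Fin m → Rd d → ℝ} (hf : ∀ j, BCS (f j))
    {u v : Rd d → ℝ} (hv : Measurable v) (huv : u =ᵐ[volume] v) (hu : ∀ᵐ x, 0 < u x)
    (hν0 : ∀ R : Cube d, weightMeasure u R.set ≠ 0)
    (hνt : ∀ R : Cube d, weightMeasure u R.set ≠ ∞)
    {k : Cube d → ℝ≥0∞} {q : ℝ} {K : ℝ≥0∞} (hq : 0 < q) (hKt : K ≠ ∞)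
    (hak : ∀ R : Cube d, (∏ j, avg (f j) 1 R) ^ q * weightMeasure u R.set ≤ k R)
    (hk : ∀ H : Finset (Cube d), (H : Set (Cube d)).PairwiseDisjoint Cube.set →
      ∑ R ∈ H, k R ≤ K ^ q)
    {E : Set (Rd d)} (hE : MeasurableSet E) {N : ℝ} (hEN : ∀ x ∈ E, |v x| ≤ N)
    (hEb : E ⊆ Metric.closedBall 0 N) (hEt : weightMeasure u E ≠ ∞)
    {l : ℝ≥0∞} (hl : ∀ x ∈ E, l ≤ ofFn (T f) x) :
    l * weightMeasure u E ^ (1 / q) ≤ CT * weakConst d m q * FW u * K := by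
  set e := weightMeasure u E with he
  by_cases he0 : e = 0
  · rw [he0, ENNReal.zero_rpow_of_pos (by positivity), mul_zero]
    exact zero_le
  by_cases hK0 : K = 0
  · have ha : ∀ R : Cube d, ∏ j, avg (f j) 1 R = 0 := by
      intro R
      have h := (hak R).trans (by simpa using hk {R} (by simp))
      rw [hK0, ENNReal.zero_rpow_of_pos hq, nonpos_iff_eq_zero, mul_eq_zero,
        ENNReal.rpow_eq_zero_iff_of_pos hq] at h
      exact h.resolve_right (hν0 R)
    have h := mul_weightMeasure_le_of_sparse hT hf hv huv hu hE hEN hEb hl (X := 0)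
      fun S _ F _ => by simp [ha]
    rw [mul_zero, nonpos_iff_eq_zero, mul_eq_zero] at h
    rw [h.resolve_right he0, zero_mul]
    exact zero_le
  have h2 : (2 ^ (d + 1) : ℝ≥0∞) ≠ 0 := pow_ne_zero _ (by norm_num)
  have h2t : (2 ^ (d + 1) : ℝ≥0∞) ≠ ∞ := ENNReal.pow_ne_top (by norm_num)
  set M : ℝ≥0∞ := (2 ^ (d + 1)) ^ (1 / q) * K * e ^ (-(1 / q)) with hMdef
  have hMt : M ≠ ∞ := ENNReal.mul_ne_top (ENNReal.mul_ne_top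
    (ENNReal.rpow_ne_top_of_nonneg (by positivity) h2t) hKt)
    (by rw [ENNReal.rpow_neg]; simp [ENNReal.rpow_eq_zero_iff, he0, hEt])
  have hMq : M ^ q = 2 ^ (d + 1) * K ^ q * e⁻¹ := by
    rw [hMdef, ENNReal.mul_rpow_of_nonneg _ _ hq.le, ENNReal.mul_rpow_of_nonneg _ _ hq.le,
      ← ENNReal.rpow_mul, ← ENNReal.rpow_mul, neg_mul, one_div, inv_mul_cancel₀ hq.ne',
      ENNReal.rpow_one, ENNReal.rpow_neg_one]
  set Ω : Set (Rd d) := ⋃ β : Fin d → Bool,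
    ⋃ i : {I // M < ∏ j, avg (f j) 1 (gridCube β I)}, (gridCube β i.1).set with hΩ
  have hΩm : MeasurableSet Ω :=
    MeasurableSet.iUnion fun β => MeasurableSet.iUnion fun i => (gridCube β i.1).measurableSet
  have hKq0 : K ^ q ≠ 0 := by simp [hK0, hKt]
  have hKqt : K ^ q ≠ ∞ := ENNReal.rpow_ne_top_of_nonneg hq.le hKt
  have hΩe : 2 * weightMeasure u Ω ≤ e := by
    have hM1 : M ^ q * weightMeasure u Ω ≤ 2 ^ d * K ^ q := by
      calc _ ≤ M ^ q * ∑ β : Fin d → Bool, weightMeasure u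
              (⋃ i : {I // M < ∏ j, avg (f j) 1 (gridCube β I)}, (gridCube β i.1).set) := by
            gcongr
            exact measure_iUnion_fintype_le _ _
        _ ≤ ∑ β : Fin d → Bool, K ^ q := by
            rw [Finset.mul_sum]
            exact Finset.sum_le_sum fun β _ => rpow_mul_measure_iUnion_le
              (a := fun R => ∏ j, avg (f j) 1 R) hq hak hk _
              (fun i j => gridCube_nested β _ _) fun i => i.2.le
        _ = _ := by simp
    rw [hMq] at hM1
    have h3 : 2 ^ d * K ^ q * (2 * weightMeasure u Ω * e⁻¹) ≤ 2 ^ d * K ^ q * 1 := by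
      calc _ = 2 ^ (d + 1) * K ^ q * e⁻¹ * weightMeasure u Ω := by ring
        _ ≤ _ := by rwa [mul_one]
    rw [ENNReal.mul_le_mul_iff_right (mul_ne_zero (pow_ne_zero _ (by norm_num)) hKq0)
      (ENNReal.mul_ne_top (ENNReal.pow_ne_top (by norm_num)) hKqt),
      ENNReal.mul_inv_le_iff he0 hEt, one_mul] at h3
    exact h3
  have hE' : e ≤ 2 * weightMeasure u (E \ Ω) := by
    have h4 : e ≤ weightMeasure u (E \ Ω) + weightMeasure u Ω := by
      rw [he]
      exact (measure_mono (by simp)).trans (measure_union_le (E \ Ω) Ω)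
    have h5 : e + e ≤ 2 * weightMeasure u (E \ Ω) + e := by
      calc e + e = 2 * e := (two_mul e).symm
        _ ≤ 2 * (weightMeasure u (E \ Ω) + weightMeasure u Ω) := by gcongr
        _ = 2 * weightMeasure u (E \ Ω) + 2 * weightMeasure u Ω := mul_add _ _ _
        _ ≤ _ := by gcongr
    exact (ENNReal.add_le_add_iff_right hEt).1 h5
  have htest := mul_weightMeasure_le_of_sparse hT hf hv huv hu (hE.diff hΩm)
    (fun x hx => hEN x hx.1) (sdiff_subset.trans hEb) (fun x hx => hl x hx.1)
    fun S hS F hF => sum_prod_avg_mul_le hu hν0 hνt hq hak hk (E := E \ Ω) (M := M.toReal)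
      ENNReal.toReal_nonneg (fun β I => by
        rw [ENNReal.ofReal_toReal hMt]
        by_cases h : M < ∏ j, avg (f j) 1 (gridCube β I)
        · refine Or.inr (Set.eq_empty_of_forall_notMem fun x hx => hx.1.2 ?_)
          exact mem_iUnion.2 ⟨β, mem_iUnion.2 ⟨⟨I, h⟩, hx.2⟩⟩
        · exact Or.inl (not_lt.1 h)) hS F hF
  rw [ENNReal.ofReal_toReal hMt] at htest
  have hle : weightMeasure u (E \ Ω) ≤ e := measure_mono sdiff_subset
  have hsplit : e ^ (1 / q) = e * e ^ (1 / q - 1) := by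
    conv_rhs => rw [← ENNReal.rpow_one e, ← ENNReal.rpow_mul, one_mul,
      ← ENNReal.rpow_add _ _ he0 hEt]
    simp
  calc l * e ^ (1 / q) ≤ l * (2 * weightMeasure u (E \ Ω) * e ^ (1 / q - 1)) := by
        rw [hsplit]
        gcongr
    _ = 2 * (l * weightMeasure u (E \ Ω)) * e ^ (1 / q - 1) := by ring
    _ ≤ 2 * (CT * ((6 ^ d) ^ m * (2 ^ d * (ENNReal.ofReal (1 + q) * M ^ (1 / (1 + q)) *
          (2 * 6 ^ d * FW u * (K ^ (q / (1 + q)) * e ^ (q / (1 + q)))))))) * e ^ (1 / q - 1) := by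
        gcongr ?_ * _
        gcongr 2 * ?_
        refine htest.trans ?_
        gcongr
    _ = CT * (2 * ((6 ^ d) ^ m * (2 ^ d * (ENNReal.ofReal (1 + q) * M ^ (1 / (1 + q)) *
          (2 * 6 ^ d * FW u * (K ^ (q / (1 + q)) * e ^ (q / (1 + q))))))) * e ^ (1 / q - 1)) := by
        ring
    _ = _ := by
        rw [hMdef, weakConst_balance d m hq hK0 hKt he0 hEt]
        ring

lemma closedBall_subset_cube (N : ℝ) (hN : 0 ≤ N) : Metric.closedBall (0 : Rd d) N ⊆
    (⟨fun _ => -N, 2 * N + 1, by linarith⟩ : Cube d).set := by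
  intro x hx i
  rw [mem_closedBall_zero_iff, pi_norm_le_iff_of_nonneg hN] at hx
  have := abs_le.1 (hx i)
  exact ⟨this.1, by simp only; linarith⟩

/-- Theorem A, first part: weighted weak-type bound with constant `[w^p]_FW [w⃗]_{p⃗}`
for `m`-sublinear operators satisfying sparse form domination, `p⃗ ∈ [1,∞]^m`. -/
theorem stmt0 (d m : ℕ) (hd : 1 ≤ d) (hm : 1 ≤ m)
    (p : Fin m → ℝ≥0∞) (hp : ∀ j, 1 ≤ p j)
    (p0 : ℝ≥0∞) (hp0top : p0 ≠ ∞) (hp0 : p0⁻¹ = ∑ j, (p j)⁻¹)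
    (CT : ℝ≥0∞) (hCT : CT ≠ ∞) :
    ∃ c : ℝ≥0∞, c ≠ ∞ ∧
      ∀ (T : (Fin m → Rd d → ℝ) → Rd d → ℝ),
        (∀ f, Measurable (T f)) → SparseFormDom T CT →
        ∀ w : Fin m → Rd d → ℝ, (∀ j, IsWeight (w j)) →
          AP p0.toReal p w ≠ ∞ →
          ∀ f : Fin m → Rd d → ℝ, (∀ j, BCS (f j)) →
            weakNorm (prodW w) p0.toReal (T f) ≤
              c * FW (fun x => prodW w x ^ p0.toReal) * AP p0.toReal p w *
                ∏ j, LpW (w j) (p j) (f j) := by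
  have hp00 : p0 ≠ 0 := by
    rintro rfl
    rw [ENNReal.inv_zero, eq_comm, ENNReal.sum_eq_top] at hp0
    obtain ⟨j, -, hj⟩ := hp0
    exact (zero_lt_one.trans_le (hp j)).ne' (ENNReal.inv_eq_top.1 hj)
  set q := p0.toReal with hqdef
  have hq : 0 < q := ENNReal.toReal_pos hp00 hp0top
  refine ⟨CT * weakConst d m q + 1,
    ENNReal.add_ne_top.2 ⟨ENNReal.mul_ne_top hCT (weakConst_ne_top d m hq), ENNReal.one_ne_top⟩,
    fun T hTm hT w hw hAP f hf => ?_⟩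
  set u : Rd d → ℝ := fun x => prodW w x ^ q with hudef
  have hum : AEMeasurable u volume := (aemeasurable_prodW hw).pow_const q
  have hu : ∀ᵐ x, 0 < u x := (prodW_pos hw).mono fun x hx => Real.rpow_pos_of_pos hx q
  have hν0 := weightMeasure_ne_zero hum hu
  have hνt : ∀ R : Cube d, weightMeasure u R.set ≠ ∞ := weightMeasure_ne_top hw hq hAP
  have hFW := FW_ne_zero hu hν0 hνt
  set K : ℝ≥0∞ := AP q p w * ∏ j, LpW (w j) (p j) (f j) with hKdef
  rw [mul_assoc _ (AP q p w)]
  by_cases hKt : K = ∞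
  · rw [← hKdef, hKt, ENNReal.mul_top (mul_ne_zero (by simp) hFW)]
    exact le_top
  set v := hum.mk u
  have hv : Measurable v := hum.measurable_mk
  refine iSup₂_le fun l hl => ?_
  set L : Set (Rd d) := {x | ENNReal.ofReal l < ofFn (T f) x}
  have hL : MeasurableSet L := by
    refine measurableSet_lt measurable_const ?_
    rw [ofFn_eq_enorm]
    exact (hTm f).enorm
  rw [← weightMeasure_rpow_eq hw hL]
  set B : ℕ → Set (Rd d) := fun n => {x | |v x| ≤ n} ∩ Metric.closedBall 0 n
  have hBm : ∀ n, MeasurableSet (B n) := fun n =>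
    (measurableSet_le hv.abs measurable_const).inter Metric.isClosed_closedBall.measurableSet
  have hBmono : Monotone fun n => L ∩ B n := by
    intro n n' h x hx
    have h' : (n : ℝ) ≤ n' := by exact_mod_cast h
    exact ⟨hx.1, le_trans hx.2.1 h', Metric.closedBall_subset_closedBall h' hx.2.2⟩
  have hLB : L = ⋃ n, L ∩ B n := by
    rw [← inter_iUnion, eq_comm, inter_eq_left]
    intro x _
    obtain ⟨n, hn⟩ := exists_nat_ge (max |v x| ‖x‖)
    exact mem_iUnion.2 ⟨n, (le_max_left _ _).trans hn,
      mem_closedBall_zero_iff.2 ((le_max_right _ _).trans hn)⟩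
  have hl0 : ENNReal.ofReal l ≠ 0 := by simpa using hl
  set X := CT * weakConst d m q * FW u * K
  have hn : ∀ n, weightMeasure u (L ∩ B n) ≤ (X / ENNReal.ofReal l) ^ q := by
    intro n
    have hfin : weightMeasure u (L ∩ B n) ≠ ∞ :=
      ne_top_of_le_ne_top (hνt _) (measure_mono (inter_subset_right.trans
        (inter_subset_right.trans (closedBall_subset_cube n n.cast_nonneg))))
    have hk : ∀ H : Finset (Cube d), (H : Set (Cube d)).PairwiseDisjoint Cube.set →
        ∑ R ∈ H, (AP q p w * ∏ j, eLpNorm (fun x => f j x * w j x) (p j)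
          (volume.restrict R.set)) ^ q ≤ K ^ q := by
      intro H hH
      simp_rw [hKdef, ENNReal.mul_rpow_of_nonneg _ _ hq.le, ← Finset.mul_sum]
      exact mul_le_mul_right (sum_prod_eLpNorm_rpow_le hp hp00 hp0top hp0
        (fun j x => f j x * w j x) H hH) _
    have := mul_weightMeasure_rpow_le hT hf hv hum.ae_eq_mk hu hν0 hνt hq hKt
      (prod_avg_rpow_mul_weightMeasure_le hp hp00 hp0top hp0 hw fun j => (hf j).1)
      hk
      (hL.inter (hBm n)) (fun x hx => hx.2.1) (inter_subset_right.trans inter_subset_right) hfin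
      (fun x hx => hx.1.le)
    rw [mul_comm, ← ENNReal.le_div_iff_mul_le (Or.inl hl0) (Or.inl ENNReal.ofReal_ne_top),
      one_div, ENNReal.rpow_inv_le_iff hq] at this
    exact this
  have hfull : weightMeasure u L ≤ (X / ENNReal.ofReal l) ^ q := by
    rw [hLB, hBmono.measure_iUnion]
    exact iSup_le hn
  rw [← ENNReal.rpow_inv_le_iff hq, ← one_div,
    ENNReal.le_div_iff_mul_le (Or.inl hl0) (Or.inl ENNReal.ofReal_ne_top), mul_comm] at hfull
  refine hfull.trans ?_
  simp only [X]
  gcongr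
  exact le_self_add

end Paper
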